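/- Let a = (a_1,…,a_n) be integers with 0 < a_1 < ⋯ < a_n. Then the set CI(a) = { j ∈ ℤ_+ : (j, j+a_1, …, j+a_n) is a CI sequence } is either finite or eventually periodic with period a_n; that is, either CI(a) is finite, or there exists N such that for all j > N, j ∈ CI(a) if and only if j + a_n ∈ CI(a). -/

import Mathlib

/-- The numerical semigroup `⟨c₁,…,c_m⟩` (as an additive submonoid of `ℕ`)
generated by a finite set `B`: all nonnegative integer combinations of the
elements of `B`. -/
def numSemigroup (B : Finset ℕ) : AddSubmonoid ℕ := AddSubmonoid.closure (B : Set ℕ)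

/-- Delorme's characterization, taken as the definition of a complete
intersection (CI) sequence, for a finite set of distinct positive integers:
either the set is a singleton, or it can be partitioned into two disjoint
nonempty parts `k₁ • B₁` and `k₂ • B₂` with `gcd(k₁,k₂) = 1`,
`k₁ ∈ ⟨B₂⟩ \ B₂`, `k₂ ∈ ⟨B₁⟩ \ B₁`, and `B₁`, `B₂` themselves CI. -/
inductive IsCI : Finset ℕ → Prop
  | single (c : ℕ) : IsCI {c}
  | split (S B₁ B₂ : Finset ℕ) (k₁ k₂ : ℕ) :
      B₁.Nonempty → B₂.Nonempty →
      S = B₁.image (fun x => k₁ * x) ∪ B₂.image (fun x => k₂ * x) →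
      Disjoint (B₁.image (fun x => k₁ * x)) (B₂.image (fun x => k₂ * x)) →
      Nat.gcd k₁ k₂ = 1 →
      k₁ ∈ numSemigroup B₂ → k₁ ∉ B₂ →
      k₂ ∈ numSemigroup B₁ → k₂ ∉ B₁ →
      IsCI B₁ → IsCI B₂ → IsCI S

/-- A CI split of the set `S` into the two parts `k₁ • B₁` and `k₂ • B₂`
(of type `(|B₁|, |B₂|)`). -/
def IsCISplit (S B₁ B₂ : Finset ℕ) (k₁ k₂ : ℕ) : Prop :=
  B₁.Nonempty ∧ B₂.Nonempty ∧
  S = B₁.image (fun x => k₁ * x) ∪ B₂.image (fun x => k₂ * x) ∧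
  Disjoint (B₁.image (fun x => k₁ * x)) (B₂.image (fun x => k₂ * x)) ∧
  Nat.gcd k₁ k₂ = 1 ∧
  k₁ ∈ numSemigroup B₂ ∧ k₁ ∉ B₂ ∧
  k₂ ∈ numSemigroup B₁ ∧ k₂ ∉ B₁ ∧
  IsCI B₁ ∧ IsCI B₂

/-- The translated sequence `a + (j) = (j, j+a₁, …, j+aₙ)` as a finite set. -/
def jSet (n : ℕ) (a : Fin n → ℕ) (j : ℕ) : Finset ℕ :=
  insert j (Finset.image (fun i => j + a i) Finset.univ)

open Finset

lemma numSemigroup_image_mul (B : Finset ℕ) (d : ℕ) :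
    numSemigroup (B.image (fun x => d * x)) =
      (numSemigroup B).map (AddMonoidHom.mulLeft d) := by
  simp [numSemigroup, AddMonoidHom.map_mclosure]

lemma mem_numSemigroup_image_mul {B : Finset ℕ} {d y : ℕ} :
    y ∈ numSemigroup (B.image (fun x => d * x)) ↔ ∃ z ∈ numSemigroup B, d * z = y := by
  simp [numSemigroup_image_mul, AddSubmonoid.mem_map]

lemma mul_mem_numSemigroup_image_mul {B : Finset ℕ} {d z : ℕ} (hd : 0 < d) :
    d * z ∈ numSemigroup (B.image (fun x => d * x)) ↔ z ∈ numSemigroup B := by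
  rw [mem_numSemigroup_image_mul]
  constructor
  · rintro ⟨w, hw, h⟩
    rwa [← Nat.eq_of_mul_eq_mul_left hd h]
  · exact fun h => ⟨z, h, rfl⟩

lemma mul_mem_image_mul {B : Finset ℕ} {d z : ℕ} (hd : 0 < d) :
    d * z ∈ B.image (fun x => d * x) ↔ z ∈ B :=
  (mul_right_injective₀ hd.ne').mem_finset_image

/-- An element of the semigroup generated by a translate `j + B` is a sum of `r` generators,
that is, `r * j` plus a sum of `r` elements of `B`. -/
lemma mem_numSemigroup_image_add {B : Finset ℕ} {j y : ℕ} :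
    y ∈ numSemigroup (B.image (fun x => j + x)) ↔
      ∃ s : Multiset ℕ, (∀ z ∈ s, z ∈ B) ∧ y = s.card * j + s.sum := by
  constructor
  · intro h
    refine AddSubmonoid.closure_induction (motive := fun y _ => ∃ s : Multiset ℕ,
      (∀ z ∈ s, z ∈ B) ∧ y = s.card * j + s.sum) ?_ ?_ ?_ h
    · intro x hx
      obtain ⟨z, hz, rfl⟩ := by simpa using hx
      exact ⟨{z}, by simpa using hz, by simp⟩
    · exact ⟨0, by simp, by simp⟩
    · rintro _ _ _ _ ⟨s, hs, rfl⟩ ⟨t, ht, rfl⟩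
      refine ⟨s + t, fun z hz => ?_, by simp; ring⟩
      rcases Multiset.mem_add.1 hz with hz | hz
      exacts [hs z hz, ht z hz]
  · rintro ⟨s, hs, rfl⟩
    induction s using Multiset.induction with
    | empty => simp
    | cons a s ih =>
      have ha : j + a ∈ numSemigroup (B.image (fun x => j + x)) :=
        AddSubmonoid.subset_closure (by simpa using hs a (by simp))
      have := add_mem ha (ih fun z hz => hs z (by simp [hz]))
      convert this using 1
      simp; ring

lemma exists_le_of_mem_numSemigroup {B : Finset ℕ} {y : ℕ} (hy : y ∈ numSemigroup B)
    (h0 : y ≠ 0) : ∃ b ∈ B, b ≤ y := by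
  have hB : B = B.image (fun x => 0 + x) := by simp
  rw [hB, mem_numSemigroup_image_add] at hy
  obtain ⟨s, hs, rfl⟩ := hy
  rcases s.empty_or_exists_mem with rfl | ⟨b, hb⟩
  · simp at h0
  · exact ⟨b, hs b hb, by simpa using Multiset.le_sum_of_mem hb⟩

lemma IsCI.nonempty {S : Finset ℕ} (h : IsCI S) : S.Nonempty := by
  cases h with
  | single c => simp
  | split _ B₁ B₂ k₁ k₂ h₁ h₂ hS => subst hS; exact (h₁.image _).inl

lemma IsCI.image_mul_prime {p : ℕ} (hp : p.Prime) {S : Finset ℕ} (h : IsCI S) :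
    IsCI (S.image (fun x => p * x)) := by
  have hinj : Function.Injective (fun x : ℕ => p * x) := mul_right_injective₀ hp.ne_zero
  induction h with
  | single c => simpa using IsCI.single (p * c)
  | split S B₁ B₂ k₁ k₂ h₁ h₂ hS hdisj hk hk₁ hk₁' hk₂ hk₂' c₁ c₂ ih₁ ih₂ =>
    have hd : Disjoint ((B₁.image (fun x => k₁ * x)).image (fun x => p * x))
        ((B₂.image (fun x => k₂ * x)).image (fun x => p * x)) :=
      (Finset.disjoint_image hinj).2 hdisj
    by_cases hpk : p ∣ k₂
    · have hpk₁ : Nat.Coprime p k₁ := (Nat.Prime.coprime_iff_not_dvd hp).2 fun h =>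
        hp.one_lt.ne' (Nat.dvd_one.1 (hk ▸ Nat.dvd_gcd h hpk))
      have e₁ : (B₁.image (fun x => k₁ * x)).image (fun x => p * x) =
          (B₁.image (fun x => p * x)).image (fun x => k₁ * x) := by
        simp only [image_image]; congr 1; funext x; simp; ring
      have e₂ : (B₂.image (fun x => k₂ * x)).image (fun x => p * x) =
          B₂.image (fun x => (p * k₂) * x) := by
        simp only [image_image]; congr 1; funext x; simp; ring
      rw [e₁, e₂] at hd
      exact IsCI.split _ (B₁.image (fun x => p * x)) B₂ k₁ (p * k₂) (h₁.image _) h₂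
        (by rw [hS, image_union, e₁, e₂]) hd (Nat.Coprime.mul_right hpk₁.symm hk) hk₁ hk₁'
        ((mul_mem_numSemigroup_image_mul hp.pos).2 hk₂)
        (fun h => hk₂' ((mul_mem_image_mul hp.pos).1 h)) ih₁ c₂
    · have hpk₂ : Nat.Coprime p k₂ := (Nat.Prime.coprime_iff_not_dvd hp).2 hpk
      have e₁ : (B₁.image (fun x => k₁ * x)).image (fun x => p * x) =
          B₁.image (fun x => (p * k₁) * x) := by
        simp only [image_image]; congr 1; funext x; simp; ring
      have e₂ : (B₂.image (fun x => k₂ * x)).image (fun x => p * x) =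
          (B₂.image (fun x => p * x)).image (fun x => k₂ * x) := by
        simp only [image_image]; congr 1; funext x; simp; ring
      rw [e₁, e₂] at hd
      exact IsCI.split _ B₁ (B₂.image (fun x => p * x)) (p * k₁) k₂ h₁ (h₂.image _)
        (by rw [hS, image_union, e₁, e₂]) hd (Nat.Coprime.mul_left hpk₂ hk)
        ((mul_mem_numSemigroup_image_mul hp.pos).2 hk₁)
        (fun h => hk₁' ((mul_mem_image_mul hp.pos).1 h)) hk₂ hk₂' c₁ ih₂

lemma exists_eq_image_mul {B : Finset ℕ} {d : ℕ} (h : ∀ b ∈ B, d ∣ b) :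
    ∃ B' : Finset ℕ, B = B'.image (fun x => d * x) := by
  refine ⟨B.image (fun x => x / d), ?_⟩
  rw [image_image]
  conv_lhs => rw [← image_id (s := B)]
  exact image_congr fun b hb => (Nat.mul_div_cancel' (h b hb)).symm

lemma IsCI.of_image_mul_prime {p : ℕ} (hp : p.Prime) {S : Finset ℕ}
    (h : IsCI (S.image (fun x => p * x))) : IsCI S := by
  have hinj : Function.Injective (fun x : ℕ => p * x) := mul_right_injective₀ hp.ne_zero
  generalize hT : S.image (fun x => p * x) = T at h
  induction h generalizing S with
  | single c =>
    obtain ⟨x, hx⟩ : S.Nonempty := by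
      rw [← Finset.image_nonempty (f := fun x => p * x), hT]; simp
    obtain rfl : S = {x} := by
      refine eq_singleton_iff_unique_mem.2 ⟨hx, fun y hy => hinj ?_⟩
      have h₁ := hT ▸ mem_image_of_mem (fun x => p * x) hx
      have h₂ := hT ▸ mem_image_of_mem (fun x => p * x) hy
      rw [mem_singleton] at h₁ h₂
      exact h₂.trans h₁.symm
    exact IsCI.single x
  | split T B₁ B₂ k₁ k₂ h₁ h₂ hS hdisj hk hk₁ hk₁' hk₂ hk₂' c₁ c₂ ih₁ ih₂ =>
    have hdvd : ∀ t ∈ T, p ∣ t := by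
      intro t ht
      rw [← hT] at ht
      obtain ⟨x, -, rfl⟩ := mem_image.1 ht
      exact Dvd.intro x rfl
    by_cases hpk : p ∣ k₂
    · have hpk₁ : ¬ p ∣ k₁ := fun h =>
        hp.one_lt.ne' (Nat.dvd_one.1 (hk ▸ Nat.dvd_gcd h hpk))
      obtain ⟨B, rfl⟩ : ∃ B : Finset ℕ, B₁ = B.image (fun x => p * x) := by
        refine exists_eq_image_mul fun b hb => (hp.dvd_mul.1 (hdvd (k₁ * b) ?_)).resolve_left hpk₁
        rw [hS]
        exact mem_union_left _ (mem_image_of_mem _ hb)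
      obtain ⟨k, rfl⟩ := hpk
      have e₁ : (B.image (fun x => p * x)).image (fun x => k₁ * x) =
          (B.image (fun x => k₁ * x)).image (fun x => p * x) := by
        simp only [image_image]; congr 1; funext x; simp; ring
      have e₂ : B₂.image (fun x => (p * k) * x) =
          (B₂.image (fun x => k * x)).image (fun x => p * x) := by
        simp only [image_image]; congr 1; funext x; simp; ring
      rw [e₁, e₂] at hdisj hS
      refine IsCI.split _ B B₂ k₁ k (by simpa using h₁) h₂ ?_
        ((Finset.disjoint_image hinj).1 hdisj) (Nat.Coprime.coprime_mul_left_right hk) hk₁ hk₁'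
        ((mul_mem_numSemigroup_image_mul hp.pos).1 hk₂)
        (fun h => hk₂' ((mul_mem_image_mul hp.pos).2 h)) (ih₁ rfl) c₂
      exact image_injective hinj (by rw [hT, hS, image_union])
    · obtain ⟨B, rfl⟩ : ∃ B : Finset ℕ, B₂ = B.image (fun x => p * x) := by
        refine exists_eq_image_mul fun b hb => (hp.dvd_mul.1 (hdvd (k₂ * b) ?_)).resolve_left hpk
        rw [hS]
        exact mem_union_right _ (mem_image_of_mem _ hb)
      obtain ⟨k, -, rfl⟩ := mem_numSemigroup_image_mul.1 hk₁
      have e₁ : B₁.image (fun x => (p * k) * x) =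
          (B₁.image (fun x => k * x)).image (fun x => p * x) := by
        simp only [image_image]; congr 1; funext x; simp; ring
      have e₂ : (B.image (fun x => p * x)).image (fun x => k₂ * x) =
          (B.image (fun x => k₂ * x)).image (fun x => p * x) := by
        simp only [image_image]; congr 1; funext x; simp; ring
      rw [e₁, e₂] at hdisj hS
      refine IsCI.split _ B₁ B k k₂ h₁ (by simpa using h₂) ?_
        ((Finset.disjoint_image hinj).1 hdisj) (Nat.Coprime.coprime_mul_left hk)
        ((mul_mem_numSemigroup_image_mul hp.pos).1 hk₁)
        (fun h => hk₁' ((mul_mem_image_mul hp.pos).2 h)) hk₂ hk₂' c₁ (ih₂ rfl)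
      exact image_injective hinj (by rw [hT, hS, image_union])

/-- Being a complete intersection is invariant under scaling. -/
lemma isCI_image_mul {d : ℕ} (hd : d ≠ 0) {S : Finset ℕ} :
    IsCI (S.image (fun x => d * x)) ↔ IsCI S := by
  induction d using Nat.recOnMul generalizing S with
  | zero => exact absurd rfl hd
  | one => simp
  | prime p hp => exact ⟨IsCI.of_image_mul_prime hp, IsCI.image_mul_prime hp⟩
  | mul a b iha ihb =>
    have e : S.image (fun x => a * b * x) = (S.image (fun x => b * x)).image (fun x => a * x) := by
      simp only [image_image]; congr 1; funext x; simp; ring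
    rw [e, iha (left_ne_zero_of_mul hd), ihb (right_ne_zero_of_mul hd)]

/-- Gluing one further generator `e * k` to a complete intersection `T` whose elements are all
divisible by `e * m`. -/
lemma IsCI.insert_mul {T : Finset ℕ} {e m k : ℕ} (hT : IsCI T) (he : e ≠ 0) (hm : 2 ≤ m)
    (hmk : m.Coprime k) (hdvd : ∀ t ∈ T, e * m ∣ t) (hcT : e * k ∉ T)
    (hmem : m * (e * k) ∈ numSemigroup T) (hmem' : m * (e * k) ∉ T) :
    IsCI (insert (e * k) T) := by
  obtain ⟨B, rfl⟩ := exists_eq_image_mul hdvd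
  have hem : 0 < e * m := by positivity
  have hB : IsCI B := (isCI_image_mul hem.ne').1 hT
  have hcomm : m * (e * k) = e * m * k := by ring
  have eT : B.image (fun x => e * m * x) =
      (B.image (fun x => m * x)).image (fun x => e * x) := by
    simp only [image_image]; congr 1; funext x; simp; ring
  rw [hcomm, mul_mem_numSemigroup_image_mul hem] at hmem
  rw [hcomm, mul_mem_image_mul hem] at hmem'
  rw [eT, mul_mem_image_mul (by positivity)] at hcT
  have hS : insert (e * k) (B.image (fun x => e * m * x)) =
      (insert k (B.image (fun x => m * x))).image (fun x => e * x) := by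
    rw [image_insert, eT]
  rw [hS, isCI_image_mul he]
  refine IsCI.split _ B {1} m k hB.nonempty (by simp) ?_ (by simpa using hcT) hmk ?_
    (by simp; omega) hmem hmem' hB (IsCI.single 1)
  · ext; simp
  · have h₁ : 1 ∈ numSemigroup {1} := AddSubmonoid.subset_closure (by simp)
    have := nsmul_mem h₁ m
    rwa [nsmul_one] at this

lemma mul_add_mem_numSemigroup_iff {B : Finset ℕ} {M j m x : ℕ} (hB : ∀ y ∈ B, y ≤ M)
    (hj : M * M < j) (hm : m ≤ M) (hx : x ≤ M) :
    m * (j + x) ∈ numSemigroup (B.image (fun y => j + y)) ↔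
      ∃ s : Multiset ℕ, (∀ z ∈ s, z ∈ B) ∧ s.card = m ∧ s.sum = m * x := by
  rw [mem_numSemigroup_image_add]
  refine exists_congr fun s => and_congr_right fun hs => ?_
  constructor
  · intro h
    have hsum : s.sum ≤ s.card * M := by
      simpa using Multiset.sum_le_card_nsmul s M fun z hz => hB z (hs z hz)
    have hmx : m * x ≤ M * M := Nat.mul_le_mul hm hx
    have hcard : s.card = m := by
      rcases lt_trichotomy s.card m with hlt | heq | hlt
      · have h₁ : s.card * M ≤ M * M := Nat.mul_le_mul_right _ (by omega)
        have h₂ : (s.card + 1) * j ≤ m * j := Nat.mul_le_mul_right _ hlt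
        nlinarith
      · exact heq
      · have h₂ : (m + 1) * j ≤ s.card * j := Nat.mul_le_mul_right _ hlt
        rw [mul_add] at h
        rw [add_mul] at h₂
        omega
    refine ⟨hcard, ?_⟩
    rw [hcard] at h
    linarith
  · rintro ⟨h₁, h₂⟩
    rw [h₁, h₂]; ring

/-- The data certifying that the element `j + x` of `j + A` can be glued to the others. -/
def GlueData (A : Finset ℕ) (j x e m k : ℕ) : Prop :=
  2 ≤ m ∧ j + x = e * k ∧ m.Coprime k ∧ (∀ y ∈ A.erase x, e * m ∣ j + y) ∧
    ∃ s : Multiset ℕ, (∀ z ∈ s, z ∈ A.erase x) ∧ s.card = m ∧ s.sum = m * x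

lemma le_of_two_le_card {A B R : Finset ℕ} {M j k : ℕ} (hA : ∀ y ∈ A, y ≤ M)
    (hS : A.image (fun y => j + y) = B.image (fun x => k * x) ∪ R)
    (hB : 2 ≤ B.card) : k ≤ M := by
  have key : ∀ u ∈ B, j ≤ k * u ∧ k * u ≤ j + M := by
    intro u hu
    have : k * u ∈ A.image (fun y => j + y) := by
      rw [hS]; exact mem_union_left _ (mem_image_of_mem _ hu)
    obtain ⟨y, hy, h⟩ := mem_image.1 this
    have := hA y hy
    omega
  have main : ∀ u ∈ B, ∀ v ∈ B, u < v → k ≤ M := by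
    intro u hu v hv huv
    have h₁ := key u hu
    have h₂ := key v hv
    have : k * (u + 1) ≤ k * v := Nat.mul_le_mul_left _ huv
    rw [mul_add] at this
    omega
  obtain ⟨u, hu, v, hv, huv⟩ := one_lt_card.1 hB
  rcases lt_or_gt_of_ne huv with h | h
  exacts [main u hu v hv h, main v hv u hu h]

lemma exists_glueData_of_split_singleton {A B : Finset ℕ} {M j k₁ k₂ b : ℕ}
    (hA : ∀ y ∈ A, y ≤ M) (hcard : 3 ≤ A.card) (hj : M * M < j)
    (hS : A.image (fun y => j + y) = B.image (fun x => k₁ * x) ∪ {k₂ * b})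
    (hdisj : Disjoint (B.image (fun x => k₁ * x)) {k₂ * b}) (hk : k₁.Coprime k₂)
    (hk₁0 : k₁ ≠ 0)
    (hk₁ : k₁ ∈ numSemigroup {b}) (hk₁b : k₁ ≠ b) (hk₂ : k₂ ∈ numSemigroup B) (hB : IsCI B) :
    ∃ x ∈ A, IsCI ((A.erase x).image (fun y => j + y)) ∧ ∃ e m k, GlueData A j x e m k := by
  have hinj : Function.Injective (fun y : ℕ => j + y) := add_right_injective j
  have hBcard : 2 ≤ B.card := by
    have h₁ := card_union_le (B.image (fun x => k₁ * x)) {k₂ * b}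
    rw [← hS, card_image_of_injective _ hinj, card_singleton] at h₁
    have h₂ := card_image_le (s := B) (f := fun x => k₁ * x)
    omega
  have hk₁M := le_of_two_le_card hA hS hBcard
  obtain ⟨m, rfl⟩ : ∃ m, m * b = k₁ := by
    simpa [numSemigroup, AddSubmonoid.mem_closure_singleton] using hk₁
  obtain ⟨x, hx, hxb⟩ : ∃ x ∈ A, j + x = k₂ * b := by
    have : k₂ * b ∈ A.image (fun y => j + y) := by rw [hS]; simp
    simpa using this
  have hT : (A.erase x).image (fun y => j + y) = B.image (fun x => m * b * x) := by
    rw [image_erase hinj, hS, hxb, union_comm, ← insert_eq]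
    exact erase_insert (by simpa using hdisj)
  have hm0 : m ≠ 0 := by rintro rfl; simp at hk₁0
  have hb0 : b ≠ 0 := by rintro rfl; simp at hk₁0
  have hm1 : m ≠ 1 := by rintro rfl; simp at hk₁b
  refine ⟨x, hx, by rw [hT]; exact (isCI_image_mul hk₁0).2 hB, b, m, k₂, by omega,
    by rw [hxb, mul_comm], hk.coprime_mul_right, ?_, ?_⟩
  · intro y hy
    have : j + y ∈ B.image (fun x => m * b * x) := hT ▸ mem_image_of_mem (fun y => j + y) hy
    obtain ⟨z, -, hz⟩ := mem_image.1 this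
    exact ⟨z, by rw [← hz]; ring⟩
  · have hmM : m ≤ M := (Nat.le_mul_of_pos_right m (by omega)).trans hk₁M
    rw [← mul_add_mem_numSemigroup_iff (fun y hy => hA y (mem_of_mem_erase hy)) hj hmM (hA x hx),
      hT, hxb, show m * (k₂ * b) = m * b * k₂ by ring,
      mul_mem_numSemigroup_image_mul (by omega)]
    exact hk₂

lemma exists_glueData {A : Finset ℕ} {M j : ℕ} (hA : ∀ y ∈ A, y ≤ M) (hcard : 3 ≤ A.card)
    (hj : M * M < j) (h : IsCI (A.image (fun y => j + y))) :
    ∃ x ∈ A, IsCI ((A.erase x).image (fun y => j + y)) ∧ ∃ e m k, GlueData A j x e m k := by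
  have hinj : Function.Injective (fun y : ℕ => j + y) := add_right_injective j
  rw [← card_image_of_injective _ hinj] at hcard
  generalize hS : A.image (fun y => j + y) = S at h
  cases h with
  | single c => rw [hS, card_singleton] at hcard; omega
  | split _ B₁ B₂ k₁ k₂ h₁ h₂ hS' hdisj hk hk₁ hk₁' hk₂ hk₂' c₁ c₂ =>
    rw [card_image_of_injective _ hinj] at hcard
    rw [hS'] at hS
    have hpos : ∀ s ∈ B₁.image (fun x => k₁ * x) ∪ B₂.image (fun x => k₂ * x), j ≤ s := by
      intro s hs
      rw [← hS] at hs
      obtain ⟨y, -, rfl⟩ := mem_image.1 hs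
      exact Nat.le_add_right _ _
    have hk₁0 : k₁ ≠ 0 := by
      rintro rfl
      obtain ⟨u, hu⟩ := h₁
      have := hpos (0 * u) (mem_union_left _ (mem_image_of_mem (fun x => 0 * x) hu))
      omega
    have hk₂0 : k₂ ≠ 0 := by
      rintro rfl
      obtain ⟨u, hu⟩ := h₂
      have := hpos (0 * u) (mem_union_right _ (mem_image_of_mem (fun x => 0 * x) hu))
      omega
    have hS₂ := hS
    rw [union_comm] at hS₂
    by_cases hc₂ : B₂.card ≤ 1
    · obtain ⟨b, rfl⟩ := card_eq_one.1 (le_antisymm hc₂ h₂.card_pos)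
      rw [image_singleton] at hS hdisj
      exact exists_glueData_of_split_singleton hA hcard hj hS hdisj hk hk₁0 hk₁
        (by simpa using hk₁') hk₂ c₁
    by_cases hc₁ : B₁.card ≤ 1
    · obtain ⟨b, rfl⟩ := card_eq_one.1 (le_antisymm hc₁ h₁.card_pos)
      rw [image_singleton] at hS₂ hdisj
      exact exists_glueData_of_split_singleton hA hcard hj hS₂ hdisj.symm
        (Nat.Coprime.symm hk) hk₂0 hk₂ (by simpa using hk₂') hk₁ c₂
    exfalso
    have hM₁ := le_of_two_le_card hA hS (by omega)
    have hM₂ := le_of_two_le_card hA hS₂ (by omega)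
    obtain ⟨b, hb, hbk⟩ := exists_le_of_mem_numSemigroup hk₁ hk₁0
    have := hpos (k₂ * b) (mem_union_right _ (mem_image_of_mem (fun x => k₂ * x) hb))
    have : k₂ * b ≤ M * M := Nat.mul_le_mul hM₂ (hbk.trans hM₁)
    omega

lemma GlueData.ne_zero {A : Finset ℕ} {j x e m k : ℕ} (h : GlueData A j x e m k) : x ≠ 0 := by
  rintro rfl
  obtain ⟨hm, -, -, -, s, hs, hc, hsum⟩ := h
  obtain ⟨z, hz⟩ := Multiset.card_pos_iff_exists_mem.1 (by omega : 0 < s.card)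
  have h₁ := Multiset.le_sum_of_mem hz
  have h₂ := ne_of_mem_erase (hs z hz)
  omega

lemma GlueData.ne_max {A : Finset ℕ} {M j x e m k : ℕ} (hA : ∀ y ∈ A, y ≤ M)
    (h : GlueData A j x e m k) : x ≠ M := by
  rintro rfl
  have hx0 : x ≠ 0 := h.ne_zero
  obtain ⟨hm, -, -, -, s, hs, hc, hsum⟩ := h
  have : s.sum ≤ s.card * (x - 1) := by
    simpa using Multiset.sum_le_card_nsmul s (x - 1) fun z hz => by
      have h₁ := hA z (mem_of_mem_erase (hs z hz))
      have h₂ := ne_of_mem_erase (hs z hz)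
      omega
  rw [hsum, hc] at this
  have := Nat.le_of_mul_le_mul_left this (by omega)
  omega

lemma GlueData.mul_dvd {A : Finset ℕ} {M j x e m k : ℕ} (h : GlueData A j x e m k)
    (h0 : 0 ∈ A.erase x) (hM : M ∈ A.erase x) : e * m ∣ M :=
  (Nat.dvd_add_right (by simpa using h.2.2.2.1 0 h0)).1 (h.2.2.2.1 M hM)

lemma GlueData.isCI {A : Finset ℕ} {M j x e m k : ℕ} (hA : ∀ y ∈ A, y ≤ M) (hj : M * M < j)
    (hM0 : 0 < M) (hxA : x ∈ A) (h0 : 0 ∈ A) (hM : M ∈ A)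
    (hT : IsCI ((A.erase x).image (fun y => j + y))) (h : GlueData A j x e m k) :
    IsCI (A.image (fun y => j + y)) := by
  have hdvd : e * m ∣ M := h.mul_dvd (mem_erase.2 ⟨h.ne_zero.symm, h0⟩)
    (mem_erase.2 ⟨(h.ne_max hA).symm, hM⟩)
  have hmM : m ≤ M := Nat.le_of_dvd hM0 ((Dvd.intro_left e rfl).trans hdvd)
  obtain ⟨hm, hx, hmk, hd, hs⟩ := h
  have he : e ≠ 0 := by rintro rfl; simp at hx; omega
  rw [← mul_add_mem_numSemigroup_iff (fun y hy => hA y (mem_of_mem_erase hy)) hj hmM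
    (hA x hxA), hx] at hs
  have hA' : A.image (fun y => j + y) =
      insert (e * k) ((A.erase x).image (fun y => j + y)) := by
    rw [← hx, ← image_insert (fun y => j + y), insert_erase hxA]
  rw [hA']
  refine hT.insert_mul he hm hmk ?_ ?_ hs ?_
  · intro t ht
    obtain ⟨y, hy, rfl⟩ := mem_image.1 ht
    exact hd y hy
  · rw [← hx]; simp
  · rw [← hx]
    intro hmem
    obtain ⟨y, hy, hyx⟩ := mem_image.1 hmem
    have h₁ := hA y (mem_of_mem_erase hy)
    have h₂ : 2 * (j + x) ≤ m * (j + x) := Nat.mul_le_mul_right _ hm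
    have h₃ : M ≤ M * M := Nat.le_mul_of_pos_left M hM0
    omega

lemma exists_glueData_add_iff {A : Finset ℕ} {M j x : ℕ} (hA : ∀ y ∈ A, y ≤ M) (hj : 0 < j)
    (h0 : 0 ∈ A) (hM : M ∈ A) :
    (∃ e m k, GlueData A j x e m k) ↔ ∃ e m k, GlueData A (j + M) x e m k := by
  constructor
  · rintro ⟨e, m, k, h⟩
    obtain ⟨q, hq⟩ : e * m ∣ M := h.mul_dvd (mem_erase.2 ⟨h.ne_zero.symm, h0⟩)
      (mem_erase.2 ⟨(h.ne_max hA).symm, hM⟩)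
    obtain ⟨hm, hx, hmk, hd, hs⟩ := h
    refine ⟨e, m, k + m * q, hm, ?_, by simpa using hmk, fun y hy => ?_, hs⟩
    · rw [mul_add, ← hx, ← mul_assoc, ← hq]; ring
    · rw [add_right_comm]; exact dvd_add (hd y hy) ⟨q, hq⟩
  · rintro ⟨e, m, k, h⟩
    obtain ⟨q, hq⟩ : e * m ∣ M := h.mul_dvd (mem_erase.2 ⟨h.ne_zero.symm, h0⟩)
      (mem_erase.2 ⟨(h.ne_max hA).symm, hM⟩)
    obtain ⟨hm, hx, hmk, hd, hs⟩ := h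
    have hxq : j + x + e * (m * q) = e * k := by rw [← mul_assoc, ← hq, ← hx]; ring
    have hle : m * q ≤ k := by
      by_contra! hlt
      have := Nat.mul_le_mul_left e hlt.le
      omega
    obtain ⟨l, rfl⟩ := Nat.exists_eq_add_of_le hle
    refine ⟨e, m, l, hm, by linarith, by simpa using hmk, fun y hy => ?_, hs⟩
    have := hd y hy
    rw [add_right_comm] at this
    exact (Nat.dvd_add_left ⟨q, hq⟩).1 this

lemma isCI_pair {j M : ℕ} (hM0 : 0 < M) (hj : M < j) : IsCI {j, j + M} := by
  obtain ⟨e, m, q, he, hmq, hjm, hMq⟩ := Nat.exists_coprime' (Nat.gcd_pos_of_pos_right j hM0)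
  have hm2 : 2 ≤ m := by
    by_contra! hlt
    have h₁ : m * e ≤ 1 * e := Nat.mul_le_mul_right e (by omega)
    have h₂ : e ≤ q * e := Nat.le_mul_of_pos_left e (Nat.pos_of_mul_pos_right (hMq ▸ hM0))
    omega
  have hc : j + M = e * (m + q) := by rw [hjm, hMq]; ring
  have hmul : m * (e * (m + q)) = (m + q) * j := by rw [hjm]; ring
  rw [pair_comm, hc]
  refine (IsCI.single j).insert_mul he.ne' hm2 (by simpa using hmq) ?_ ?_ ?_ ?_
  · simp [hjm, mul_comm]
  · rw [← hc, mem_singleton]; omega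
  · rw [hmul]
    exact nsmul_mem (AddSubmonoid.subset_closure (by simp) : j ∈ numSemigroup {j}) (m + q)
  · rw [← hc, mem_singleton]
    have := Nat.mul_le_mul_right (j + M) hm2
    omega

theorem isCI_image_add_iff {A : Finset ℕ} {M j : ℕ} (hA : ∀ y ∈ A, y ≤ M) (hM0 : 0 < M)
    (h0 : 0 ∈ A) (hM : M ∈ A) (hj : M * M < j) :
    IsCI (A.image (fun y => j + y)) ↔ IsCI (A.image (fun y => j + M + y)) := by
  induction hn : A.card using Nat.strong_induction_on generalizing A with
  | _ n ih =>
  have hMj : M < j := (Nat.le_mul_of_pos_left M hM0).trans_lt hj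
  have hsub : {0, M} ⊆ A := by
    intro y hy
    rcases mem_insert.1 hy with rfl | hy
    exacts [h0, mem_singleton.1 hy ▸ hM]
  have hpair : ({0, M} : Finset ℕ).card = 2 := card_pair hM0.ne
  by_cases hcard : A.card ≤ 2
  · obtain rfl := eq_of_subset_of_card_le hsub (by omega)
    simpa [image_insert] using
      iff_of_true (isCI_pair hM0 hMj) (isCI_pair hM0 (hMj.trans_le (Nat.le_add_right j M)))
  · have key : ∀ i, M * M < i → (IsCI (A.image (fun y => i + y)) ↔
        ∃ x ∈ A, IsCI ((A.erase x).image (fun y => i + y)) ∧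
          ∃ e m k, GlueData A i x e m k) := by
      refine fun i hi => ⟨exists_glueData hA (by omega) hi, ?_⟩
      rintro ⟨x, hx, hT, e, m, k, h⟩
      exact h.isCI hA hi hM0 hx h0 hM hT
    rw [key j hj, key (j + M) (by omega)]
    refine exists_congr fun x => and_congr_right fun hx => ?_
    rw [← exists_glueData_add_iff hA (by omega) h0 hM]
    refine and_congr_left ?_
    rintro ⟨e, m, k, h⟩
    exact ih _ (hn ▸ card_erase_lt_of_mem hx) (fun y hy => hA y (mem_of_mem_erase hy))
      (mem_erase.2 ⟨h.ne_zero.symm, h0⟩) (mem_erase.2 ⟨(h.ne_max hA).symm, hM⟩) rfl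

/-- first part of Theorem `main`: the set
`CI(a) = {j ∈ ℤ₊ : (j, j+a₁, …, j+aₙ) is CI}` is either finite or eventually
periodic with period `aₙ`. -/
theorem ci_set_finite_or_periodic (n : ℕ) (hn : 1 ≤ n) (a : Fin n → ℕ)
    (ha0 : 0 < a ⟨0, by omega⟩) (hmono : StrictMono a) :
    ({j : ℕ | 0 < j ∧ IsCI (jSet n a j)}.Finite) ∨
    ∃ N : ℕ, ∀ j > N,
      (IsCI (jSet n a j) ↔ IsCI (jSet n a (j + a ⟨n - 1, by omega⟩))) := by
  right
  set M := a ⟨n - 1, by omega⟩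
  have hle : ∀ i, a i ≤ M := fun i => hmono.monotone (Fin.mk_le_mk.2 (by omega))
  have hset : ∀ j, jSet n a j = (insert 0 (univ.image a)).image (fun y => j + y) := by
    intro j
    simp only [jSet, image_insert, image_image, add_zero]
    rfl
  refine ⟨M * M, fun j hj => ?_⟩
  rw [hset, hset]
  refine isCI_image_add_iff ?_ (ha0.trans_le (hle _)) (mem_insert_self _ _)
    (mem_insert_of_mem (mem_image_of_mem a (mem_univ _))) hj
  intro y hy
  rcases mem_insert.1 hy with rfl | hy
  · exact Nat.zero_le _
  · obtain ⟨i, -, rfl⟩ := mem_image.1 hy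
    exact hle i
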